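/- Let ℒ be a lattice on ℝ and let f be 𝔄_∞-measurable such that Δ_I f = 0 for all but finitely many I ∈ ℒ, E_I f = 0 for all but finitely many I ∈ 𝔄^{0,fin}_{−∞}, and f = Σ_{I∈ℒ} Δ_I f + Σ_{I∈𝔄^{0,fin}_{−∞}} E_I f. Then there exists an absolute constant C > 0 (independent of ℒ and f) and a function g in martingale BMO with ‖g‖_BMO ≤ C such that ∫_ℝ Sf = ∫_ℝ f g. -/

import Mathlib

open MeasureTheory Set Filter
open scoped ENNReal Topology Classical

noncomputable section

/-- The average `⟨f⟩_I = (1/|I|) ∫_I f` of `f` over a set `I`. -/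
def avgOn (f : ℝ → ℝ) (I : Set ℝ) : ℝ := (MeasureTheory.volume I).toReal⁻¹ * ∫ x in I, f x

/-- The averaging operator `E_I f = ⟨f⟩_I · 1_I`. -/
def avgInd (f : ℝ → ℝ) (I : Set ℝ) : ℝ → ℝ := I.indicator fun _ => avgOn f I

/-- A lattice `ℒ` on `ℝ`: a family of generations `ℒ_k`, `k ∈ ℤ`, each a collection of
pairwise disjoint nontrivial finite intervals covering `ℝ`, each interval of generation `k`
being a finite (disjoint) union of intervals of generation `k+1`. -/
structure RLattice where
  gen : ℤ → Set (Set ℝ)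
  isInterval : ∀ k : ℤ, ∀ I ∈ gen k, ∃ a b : ℝ, a < b ∧ I = Set.Ico a b
  pairwise_disjoint : ∀ k : ℤ, (gen k).PairwiseDisjoint id
  covers : ∀ k : ℤ, ⋃₀ gen k = Set.univ
  subdiv : ∀ k : ℤ, ∀ J ∈ gen (k + 1), ∀ I ∈ gen k, J ⊆ I ∨ Disjoint J I
  finite_children : ∀ k : ℤ, ∀ I ∈ gen k, {J | J ∈ gen (k + 1) ∧ J ⊆ I}.Finite

namespace RLattice

variable (L : RLattice)

/-- The collection of all intervals of the lattice. -/
def lat : Set (Set ℝ) := {I | ∃ k, I ∈ L.gen k}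

/-- The conditional expectation `E_k f = Σ_{I ∈ ℒ_k} E_I f`. -/
def Ek (f : ℝ → ℝ) (k : ℤ) (x : ℝ) : ℝ := ∑' I : L.gen k, avgInd f I.1 x

/-- The children of `I`: the intervals `J ∈ ℒ_{rk(I)+1}`, `J ⊆ I`, where `rk(I)` is the
largest `k` with `I ∈ ℒ_k`. -/
def children (I : Set ℝ) : Set (Set ℝ) :=
  {J | ∃ k : ℤ, I ∈ L.gen k ∧ I ∉ L.gen (k + 1) ∧ J ∈ L.gen (k + 1) ∧ J ⊆ I}

/-- The difference operator `Δ_I f = -E_I f + Σ_{J ∈ child(I)} E_J f` (interpreted as `0`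
when `I` has no finite rank, i.e. no children). -/
def deltaI (f : ℝ → ℝ) (I : Set ℝ) (x : ℝ) : ℝ :=
  if (L.children I).Nonempty then (∑' J : L.children I, avgInd f J.1 x) - avgInd f I x else 0

/-- The martingale difference `Δ_k f = E_k f - E_{k-1} f`. -/
def deltaK (f : ℝ → ℝ) (k : ℤ) (x : ℝ) : ℝ := L.Ek f k x - L.Ek f (k - 1) x

/-- The collection `𝔄⁰_{-∞,fin}` of finite-measure intervals of the form `⋃_k I_k`,
`I_k ∈ ℒ_k`, `I_k ⊆ I_{k-1}`. -/
def AFin : Set (Set ℝ) :=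
  {I | MeasureTheory.volume I < ⊤ ∧ ∃ c : ℤ → Set ℝ,
    (∀ k, c k ∈ L.gen k) ∧ (∀ k, c k ⊆ c (k - 1)) ∧ I = ⋃ k, c k}

/-- `f` is `𝔄_∞`-measurable: Borel measurable and constant on every interval of the form
`⋂_k I_k`, `I_k ∈ ℒ_k`, `I_k ⊆ I_{k-1}`. -/
def AInfMeasurable (f : ℝ → ℝ) : Prop :=
  Measurable f ∧ ∀ c : ℤ → Set ℝ, (∀ k, c k ∈ L.gen k) → (∀ k, c k ⊆ c (k - 1)) →
    ∀ x ∈ ⋂ k, c k, ∀ y ∈ ⋂ k, c k, f x = f y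

/-- The maximal function `Mf(x) = sup {|⟨f⟩_I| : I ∈ ℒ, x ∈ I}`, valued in `[0,∞]`. -/
def maxFn (f : ℝ → ℝ) (x : ℝ) : ℝ≥0∞ :=
  ⨆ (I : Set ℝ) (_ : I ∈ L.lat ∧ x ∈ I), ENNReal.ofReal |avgOn f I|

/-- The square function
`Sf = (Σ_{I ∈ ℒ} |Δ_I f|² + Σ_{I ∈ 𝔄⁰_{-∞,fin}} |E_I f|²)^{1/2}`, valued in `[0,∞]`. -/
def sqFn (f : ℝ → ℝ) (x : ℝ) : ℝ≥0∞ :=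
  ((∑' I : L.lat, ENNReal.ofReal ((L.deltaI f I.1 x) ^ 2)) +
    ∑' I : L.AFin, ENNReal.ofReal ((avgInd f I.1 x) ^ 2)) ^ (1 / 2 : ℝ)

/-- `a` (nonnegative) is a Carleson sequence with constant `C`:
`Σ_{J ∈ ℒ, J ⊆ I} a_J ≤ C|I|` for every `I ∈ ℒ ∪ 𝔄⁰_{-∞,fin}`. -/
def IsCarleson (a : Set ℝ → ℝ) (C : ℝ) : Prop :=
  ∀ I ∈ L.lat ∪ L.AFin,
    ∑' J : {J : Set ℝ // J ∈ L.lat ∧ J ⊆ I}, ENNReal.ofReal (a J.1)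
      ≤ ENNReal.ofReal C * MeasureTheory.volume I

/-- The balayage `g = Σ_{I ∈ ℒ} (1/|I|) a_I 1_I` of a sequence `(a_I)_{I ∈ ℒ}`. -/
def balayage (a : Set ℝ → ℝ) (x : ℝ) : ℝ :=
  ∑' I : L.lat, (I.1).indicator (fun _ => (MeasureTheory.volume I.1).toReal⁻¹ * a I.1) x

/-- `g` is in martingale BMO with constant `C`:
`(1/|I| ∫_I Σ_{J ∈ ℒ, J ⊆ I} |Δ_J g|²)^{1/2} ≤ C` and `‖Δ_I g‖_∞ ≤ C` for all `I ∈ ℒ`.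
(`‖g‖_BMO ≤ C` iff this holds.) -/
def IsBMOWith (g : ℝ → ℝ) (C : ℝ) : Prop :=
  (∀ I ∈ L.lat,
    ∫⁻ x in I, ∑' J : {J : Set ℝ // J ∈ L.lat ∧ J ⊆ I}, ENNReal.ofReal ((L.deltaI g J.1 x) ^ 2)
      ≤ ENNReal.ofReal (C ^ 2) * MeasureTheory.volume I) ∧
  ∀ I ∈ L.lat, ∀ᵐ x ∂MeasureTheory.volume, |L.deltaI g I x| ≤ C

/-- The truncated square function `S_k f = (Σ_{l ≤ k} |Δ_l f|²)^{1/2}`. -/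
def sqPart (f : ℝ → ℝ) (k : ℤ) (x : ℝ) : ℝ≥0∞ :=
  (∑' l : {l : ℤ // l ≤ k}, ENNReal.ofReal ((L.deltaK f l.1 x) ^ 2)) ^ (1 / 2 : ℝ)

/-- The square function `S'f = (Σ_{k ∈ ℤ} |Δ_k f|²)^{1/2}` (summed by generations). -/
def sqFull (f : ℝ → ℝ) (x : ℝ) : ℝ≥0∞ :=
  (∑' k : ℤ, ENNReal.ofReal ((L.deltaK f k x) ^ 2)) ^ (1 / 2 : ℝ)

end RLattice

namespace RLattice

variable {L : RLattice}

/-- auxiliary: `ch` is the finite set of children of `I`, which has rank `k`. -/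
structure IsCh (L : RLattice) (I : Set ℝ) (k : ℤ) (ch : Finset (Set ℝ)) : Prop where
  mem : I ∈ L.gen k
  notMem : I ∉ L.gen (k + 1)
  sub : ∀ J ∈ ch, J ∈ L.gen (k + 1) ∧ J ⊆ I
  cov : ∀ x ∈ I, ∃ J ∈ ch, x ∈ J
  delta : ∀ f x, L.deltaI f I x = (∑ J ∈ ch, avgInd f J x) - avgInd f I x

lemma gen_meas {k : ℤ} {I : Set ℝ} (h : I ∈ L.gen k) : MeasurableSet I := by
  obtain ⟨a, b, _, rfl⟩ := L.isInterval k I h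
  exact measurableSet_Ico

lemma gen_fin {k : ℤ} {I : Set ℝ} (h : I ∈ L.gen k) : volume I < ⊤ := by
  obtain ⟨a, b, _, rfl⟩ := L.isInterval k I h
  simp

lemma gen_pos {k : ℤ} {I : Set ℝ} (h : I ∈ L.gen k) : 0 < (volume I).toReal := by
  obtain ⟨a, b, hab, rfl⟩ := L.isInterval k I h
  rw [Real.volume_Ico, ENNReal.toReal_ofReal (by linarith)]
  linarith

lemma gen_ne {k : ℤ} {I : Set ℝ} (h : I ∈ L.gen k) : I.Nonempty := by
  obtain ⟨a, b, hab, rfl⟩ := L.isInterval k I h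
  simpa using hab

lemma gen_ex (L : RLattice) (k : ℤ) (x : ℝ) : ∃ I ∈ L.gen k, x ∈ I := by
  have : x ∈ ⋃₀ L.gen k := by rw [L.covers k]; trivial
  simpa using this

lemma gen_uniq {k : ℤ} {I J : Set ℝ} (hI : I ∈ L.gen k) (hJ : J ∈ L.gen k) {x : ℝ}
    (h1 : x ∈ I) (h2 : x ∈ J) : I = J := by
  by_contra hne
  exact Set.disjoint_left.1 (L.pairwise_disjoint k hI hJ hne) h1 h2

lemma nested_nat (n : ℕ) : ∀ {k : ℤ} {I J : Set ℝ}, I ∈ L.gen k → J ∈ L.gen (k + n) →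
    J ⊆ I ∨ Disjoint J I := by
  induction n with
  | zero =>
    intro k I J hI hJ
    simp only [Nat.cast_zero, add_zero] at hJ
    by_cases h : J = I
    · left; rw [h]
    · right; exact L.pairwise_disjoint k hJ hI h
  | succ n ih =>
    intro k I J hI hJ
    have hJ' : J ∈ L.gen (k + n + 1) := by
      have : k + ((n + 1 : ℕ) : ℤ) = k + n + 1 := by push_cast; ring
      rwa [this] at hJ
    obtain ⟨x, hx⟩ := gen_ne hJ
    obtain ⟨J', hJ'm, hxJ'⟩ := gen_ex L (k + n) x
    have hs : J ⊆ J' := by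
      rcases L.subdiv _ J hJ' J' hJ'm with h | h
      · exact h
      · exact absurd hxJ' (Set.disjoint_left.1 h hx)
    rcases ih hI hJ'm with h | h
    · left; exact hs.trans h
    · right; exact h.mono_left hs

lemma nested {k m : ℤ} (hkm : k ≤ m) {I J : Set ℝ} (hI : I ∈ L.gen k) (hJ : J ∈ L.gen m) :
    J ⊆ I ∨ Disjoint J I := by
  obtain ⟨n, rfl⟩ := Int.le.dest hkm
  exact nested_nat n hI hJ

lemma gen_between {k j m : ℤ} (h1 : k ≤ j) (h2 : j ≤ m) {I : Set ℝ} (hI : I ∈ L.gen k)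
    (hI' : I ∈ L.gen m) : I ∈ L.gen j := by
  obtain ⟨x, hx⟩ := gen_ne hI
  obtain ⟨A, hA, hxA⟩ := gen_ex L j x
  have e1 : A ⊆ I := (nested h1 hI hA).resolve_right fun h => Set.disjoint_left.1 h hxA hx
  have e2 : I ⊆ A := (nested h2 hA hI').resolve_right fun h => Set.disjoint_left.1 h hx hxA
  rwa [e2.antisymm e1]

lemma rank_uniq {k m : ℤ} {I : Set ℝ} (hk : I ∈ L.gen k) (hk' : I ∉ L.gen (k + 1))
    (hm : I ∈ L.gen m) : m ≤ k := by
  by_contra h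
  exact hk' (gen_between (by omega) (by omega) hk hm)

lemma exists_ch (I : Set ℝ) (hI : (L.children I).Nonempty) : ∃ k ch, L.IsCh I k ch := by
  obtain ⟨J, k, hk, hk', hJ, hJI⟩ := hI
  have hset : L.children I = {J | J ∈ L.gen (k + 1) ∧ J ⊆ I} := by
    ext A
    constructor
    · rintro ⟨m, hm, hm', hA, hAI⟩
      have : m = k := le_antisymm (rank_uniq hk hk' hm) (rank_uniq hm hm' hk)
      subst this
      exact ⟨hA, hAI⟩
    · rintro ⟨hA, hAI⟩
      exact ⟨k, hk, hk', hA, hAI⟩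
  have hfin := L.finite_children k I hk
  refine ⟨k, hfin.toFinset, hk, hk', ?_, ?_, ?_⟩
  · intro J hJ; simpa using hJ
  · intro x hx
    obtain ⟨A, hA, hxA⟩ := gen_ex L (k + 1) x
    refine ⟨A, ?_, hxA⟩
    simp only [Set.Finite.mem_toFinset, Set.mem_ofPred_eq]
    exact ⟨hA, (nested (by omega) hk hA).resolve_right fun h => Set.disjoint_left.1 h hxA hx⟩
  · intro f x
    have hne : (L.children I).Nonempty := ⟨J, k, hk, hk', hJ, hJI⟩
    rw [deltaI, if_pos hne]
    congr 1
    rw [hset, tsum_subtype {J | J ∈ L.gen (k + 1) ∧ J ⊆ I} (fun J => avgInd f J x)]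
    rw [tsum_eq_sum (s := hfin.toFinset)]
    · apply Finset.sum_congr rfl
      intro A hA
      rw [Set.indicator_of_mem]
      simpa using hA
    · intro A hA
      rw [Set.indicator_of_notMem]
      simpa using hA

lemma delta_zero {I : Set ℝ} (hI : ¬ (L.children I).Nonempty) (f : ℝ → ℝ) (x : ℝ) :
    L.deltaI f I x = 0 := by
  rw [deltaI, if_neg hI]

lemma IsCh.sum {I : Set ℝ} {k : ℤ} {ch : Finset (Set ℝ)} (h : L.IsCh I k ch) {J : Set ℝ}
    (hJ : J ∈ ch) {x : ℝ} (hx : x ∈ J) (φ : Set ℝ → ℝ) :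
    ∑ A ∈ ch, A.indicator (fun _ => φ A) x = φ J := by
  rw [Finset.sum_eq_single J]
  · simp [hx]
  · intro A hA hne
    apply Set.indicator_of_notMem
    intro hxA
    exact hne (gen_uniq (h.sub A hA).1 (h.sub J hJ).1 hxA hx)
  · intro h'; exact absurd hJ h'

lemma IsCh.sum_out {I : Set ℝ} {k : ℤ} {ch : Finset (Set ℝ)} (h : L.IsCh I k ch)
    {x : ℝ} (hx : x ∉ I) (φ : Set ℝ → ℝ) :
    ∑ A ∈ ch, A.indicator (fun _ => φ A) x = 0 := by
  apply Finset.sum_eq_zero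
  intro A hA
  apply Set.indicator_of_notMem
  intro hxA
  exact hx ((h.sub A hA).2 hxA)

lemma IsCh.delta_in {I : Set ℝ} {k : ℤ} {ch : Finset (Set ℝ)} (h : L.IsCh I k ch) {J : Set ℝ}
    (hJ : J ∈ ch) {x : ℝ} (hx : x ∈ J) (f : ℝ → ℝ) :
    L.deltaI f I x = avgOn f J - avgOn f I := by
  rw [h.delta]
  simp only [avgInd]
  rw [h.sum hJ hx (fun A => avgOn f A), Set.indicator_of_mem ((h.sub J hJ).2 hx)]

lemma IsCh.delta_out {I : Set ℝ} {k : ℤ} {ch : Finset (Set ℝ)} (h : L.IsCh I k ch)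
    {x : ℝ} (hx : x ∉ I) (f : ℝ → ℝ) : L.deltaI f I x = 0 := by
  rw [h.delta]
  simp only [avgInd]
  rw [h.sum_out hx (fun A => avgOn f A), Set.indicator_of_notMem hx, sub_zero]

lemma avgInd_integrable {A : Set ℝ} (hA : MeasurableSet A) (hf : volume A < ⊤) (h : ℝ → ℝ) :
    Integrable (avgInd h A) := by
  unfold avgInd
  exact (integrable_indicator_iff hA).2 (integrableOn_const hf.ne)

lemma avgInd_measurable {A : Set ℝ} (hA : MeasurableSet A) (h : ℝ → ℝ) :
    Measurable (avgInd h A) := measurable_const.indicator hA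

lemma delta_integrable (I : Set ℝ) (h : ℝ → ℝ) : Integrable (L.deltaI h I) := by
  by_cases hI : (L.children I).Nonempty
  · obtain ⟨k, ch, hc⟩ := exists_ch I hI
    have : L.deltaI h I = fun x => (∑ J ∈ ch, avgInd h J x) - avgInd h I x := by
      funext x; exact hc.delta h x
    rw [this]
    refine Integrable.sub (integrable_finsetSum _ ?_)
      (avgInd_integrable (gen_meas hc.mem) (gen_fin hc.mem) h)
    intro J hJ
    exact avgInd_integrable (gen_meas (hc.sub J hJ).1) (gen_fin (hc.sub J hJ).1) h
  · have : L.deltaI h I = fun _ => 0 := by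
      funext x; exact delta_zero hI h x
    rw [this]; exact integrable_zero _ _ _

lemma delta_measurable (I : Set ℝ) (h : ℝ → ℝ) : Measurable (L.deltaI h I) := by
  by_cases hI : (L.children I).Nonempty
  · obtain ⟨k, ch, hc⟩ := exists_ch I hI
    have : L.deltaI h I = fun x => (∑ J ∈ ch, avgInd h J x) - avgInd h I x := by
      funext x; exact hc.delta h x
    rw [this]
    refine Measurable.sub (Finset.measurable_sum _ ?_)
      (avgInd_measurable (gen_meas hc.mem) h)
    intro J hJ
    exact avgInd_measurable (gen_meas (hc.sub J hJ).1) h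
  · have : L.deltaI h I = fun _ => 0 := by
      funext x; exact delta_zero hI h x
    rw [this]; exact measurable_const

lemma mul_avgInd (f h : ℝ → ℝ) (A : Set ℝ) :
    (fun x => f x * avgInd h A x) = A.indicator (fun x => f x * avgOn h A) := by
  funext x
  by_cases hx : x ∈ A <;> simp [avgInd, hx]

lemma mul_avgInd_integrable {f : ℝ → ℝ} (hf : Integrable f) (h : ℝ → ℝ) {A : Set ℝ}
    (hA : MeasurableSet A) : Integrable (fun x => f x * avgInd h A x) := by
  rw [mul_avgInd]
  exact (hf.mul_const _).indicator hA

lemma integral_mul_avgInd (f : ℝ → ℝ) (h : ℝ → ℝ) {A : Set ℝ}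
    (hA : MeasurableSet A) : ∫ x, f x * avgInd h A x = avgOn h A * ∫ x in A, f x := by
  rw [mul_avgInd, integral_indicator hA, integral_mul_const, mul_comm]

lemma avg_selfadj (f h : ℝ → ℝ) {A : Set ℝ} (hA : MeasurableSet A) :
    ∫ x, f x * avgInd h A x = ∫ x, avgInd f A x * h x := by
  have : ∫ x, avgInd f A x * h x = ∫ x, h x * avgInd f A x := by
    congr 1; funext x; ring
  rw [this, integral_mul_avgInd _ _ hA, integral_mul_avgInd _ _ hA, avgOn, avgOn]
  ring

lemma mul_delta_integrable {f : ℝ → ℝ} (hf : Integrable f) (h : ℝ → ℝ) (I : Set ℝ) :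
    Integrable (fun x => f x * L.deltaI h I x) := by
  by_cases hI : (L.children I).Nonempty
  · obtain ⟨k, ch, hc⟩ := exists_ch I hI
    have : (fun x => f x * L.deltaI h I x) =
        fun x => (∑ J ∈ ch, f x * avgInd h J x) - f x * avgInd h I x := by
      funext x; rw [hc.delta h x, mul_sub, Finset.mul_sum]
    rw [this]
    refine Integrable.sub (integrable_finsetSum _ ?_)
      (mul_avgInd_integrable hf h (gen_meas hc.mem))
    intro J hJ
    exact mul_avgInd_integrable hf h (gen_meas (hc.sub J hJ).1)
  · have : (fun x => f x * L.deltaI h I x) = fun _ => 0 := by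
      funext x; rw [delta_zero hI h x, mul_zero]
    rw [this]; exact integrable_zero _ _ _

/-- integrable when multiplied by an averaging function -/
lemma bdd_integrable {A : Set ℝ} (hA : MeasurableSet A) (hfA : volume A < ⊤) {h : ℝ → ℝ}
    (hm : Measurable h) (hb : ∀ x, |h x| ≤ 1) (f : ℝ → ℝ) :
    Integrable (fun x => avgInd f A x * h x) := by
  refine Integrable.mono' (avgInd_integrable hA hfA f).abs
    ((avgInd_measurable hA f).mul hm).aestronglyMeasurable ?_
  refine Eventually.of_forall fun x => ?_
  rw [Real.norm_eq_abs, abs_mul]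
  exact mul_le_of_le_one_right (abs_nonneg _) (hb x)

lemma delta_selfadj {f : ℝ → ℝ} (hf : Integrable f) {h : ℝ → ℝ} (hm : Measurable h)
    (hb : ∀ x, |h x| ≤ 1) (I : Set ℝ) :
    ∫ x, f x * L.deltaI h I x = ∫ x, L.deltaI f I x * h x := by
  by_cases hI : (L.children I).Nonempty
  · obtain ⟨k, ch, hc⟩ := exists_ch I hI
    have e1 : (fun x => f x * L.deltaI h I x) =
        fun x => (∑ J ∈ ch, f x * avgInd h J x) - f x * avgInd h I x := by
      funext x; rw [hc.delta h x, mul_sub, Finset.mul_sum]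
    have e2 : (fun x => L.deltaI f I x * h x) =
        fun x => (∑ J ∈ ch, avgInd f J x * h x) - avgInd f I x * h x := by
      funext x; rw [hc.delta f x, sub_mul, Finset.sum_mul]
    have i1 : ∀ J ∈ ch, Integrable (fun x => f x * avgInd h J x) := fun J hJ =>
      mul_avgInd_integrable hf h (gen_meas (hc.sub J hJ).1)
    have i2 : ∀ J ∈ ch, Integrable (fun x => avgInd f J x * h x) := fun J hJ =>
      bdd_integrable (gen_meas (hc.sub J hJ).1) (gen_fin (hc.sub J hJ).1) hm hb f
    rw [e1, e2, integral_sub (integrable_finsetSum _ i1)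
      (mul_avgInd_integrable hf h (gen_meas hc.mem)), integral_sub (integrable_finsetSum _ i2)
      (bdd_integrable (gen_meas hc.mem) (gen_fin hc.mem) hm hb f),
      integral_finsetSum _ i1, integral_finsetSum _ i2, avg_selfadj f h (gen_meas hc.mem)]
    congr 1
    apply Finset.sum_congr rfl
    intro J hJ
    exact avg_selfadj f h (gen_meas (hc.sub J hJ).1)
  · simp [delta_zero hI]

lemma avgOn_bdd {h : ℝ → ℝ} (hb : ∀ x, |h x| ≤ 1) {A : Set ℝ} (hA : volume A < ⊤) :
    |avgOn h A| ≤ 1 := by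
  have := norm_setIntegral_le_of_norm_le_const (μ := volume) (f := h) (C := 1) hA
    (fun x _ => by simpa using hb x)
  rw [avgOn, abs_mul, abs_inv, abs_of_nonneg ENNReal.toReal_nonneg]
  rw [Real.norm_eq_abs, one_mul, measureReal_def] at this
  calc _ ≤ (volume A).toReal⁻¹ * (volume A).toReal := by gcongr
    _ ≤ 1 := inv_mul_le_one

lemma delta_bdd {h : ℝ → ℝ} (hb : ∀ x, |h x| ≤ 1) (I : Set ℝ) (x : ℝ) :
    |L.deltaI h I x| ≤ 2 := by
  by_cases hI : (L.children I).Nonempty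
  · obtain ⟨k, ch, hc⟩ := exists_ch I hI
    by_cases hx : x ∈ I
    · obtain ⟨J, hJ, hxJ⟩ := hc.cov x hx
      rw [hc.delta_in hJ hxJ]
      have a1 := abs_le.1 (avgOn_bdd hb (gen_fin hc.mem))
      have a2 := abs_le.1 (avgOn_bdd hb (gen_fin (hc.sub J hJ).1))
      rw [abs_le]; constructor <;> linarith [a1.1, a1.2, a2.1, a2.2]
    · rw [hc.delta_out hx]; simp
  · rw [delta_zero hI]; simp

lemma avgOn_congr_const {u : ℝ → ℝ} {c : ℝ} {A : Set ℝ} (hA : MeasurableSet A)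
    (hp : 0 < (volume A).toReal) (h : ∀ x ∈ A, u x = c) : avgOn u A = c := by
  rw [avgOn, setIntegral_congr_fun hA (g := fun _ => c) h, setIntegral_const, measureReal_def,
    smul_eq_mul, ← mul_assoc, inv_mul_cancel₀ hp.ne', one_mul]

lemma delta_of_const {u : ℝ → ℝ} {I : Set ℝ} (c : ℝ) (h : ∀ x ∈ I, u x = c) (x : ℝ) :
    L.deltaI u I x = 0 := by
  by_cases hI : (L.children I).Nonempty
  · obtain ⟨k, ch, hc⟩ := exists_ch I hI
    by_cases hx : x ∈ I
    · obtain ⟨J, hJ, hxJ⟩ := hc.cov x hx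
      obtain ⟨hg, hs⟩ := hc.sub J hJ
      rw [hc.delta_in hJ hxJ, avgOn_congr_const (gen_meas hc.mem) (gen_pos hc.mem) h,
        avgOn_congr_const (gen_meas hg) (gen_pos hg) (fun y hy => h y (hs hy)), sub_self]
    · rw [hc.delta_out hx]
  · rw [delta_zero hI]

lemma avgInd_const_on {A B : Set ℝ} (h : B ⊆ A ∨ Disjoint B A) (f : ℝ → ℝ) :
    ∃ c, ∀ x ∈ B, avgInd f A x = c := by
  rcases h with h | h
  · exact ⟨avgOn f A, fun x hx => Set.indicator_of_mem (h hx) _⟩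
  · exact ⟨0, fun x hx => Set.indicator_of_notMem (Set.disjoint_left.1 h hx) _⟩

lemma IsCh.split {I : Set ℝ} {k : ℤ} {ch : Finset (Set ℝ)} (h : L.IsCh I k ch) {u : ℝ → ℝ}
    (hu : IntegrableOn u I) : ∑ J ∈ ch, ∫ x in J, u x = ∫ x in I, u x := by
  have hI : I = ⋃ J ∈ ch, J := by
    ext x
    simp only [Set.mem_iUnion, exists_prop]
    exact ⟨h.cov x, fun ⟨J, hJ, hx⟩ => (h.sub J hJ).2 hx⟩
  conv_rhs => rw [hI]
  rw [integral_biUnion_finset]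
  · intro J hJ; exact gen_meas (h.sub J hJ).1
  · intro A hA B hB hne
    exact L.pairwise_disjoint (k + 1) (h.sub A hA).1 (h.sub B hB).1 hne
  · intro J hJ; exact hu.mono_set (h.sub J hJ).2

lemma avg_mul_vol {k : ℤ} {I : Set ℝ} (h : I ∈ L.gen k) (u : ℝ → ℝ) :
    (volume I).toReal * avgOn u I = ∫ x in I, u x := by
  rw [avgOn, ← mul_assoc, mul_inv_cancel₀ (gen_pos h).ne', one_mul]

lemma IsCh.integral_delta {I : Set ℝ} {k : ℤ} {ch : Finset (Set ℝ)} (h : L.IsCh I k ch)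
    {u : ℝ → ℝ} (hu : IntegrableOn u I) : ∫ x, L.deltaI u I x = 0 := by
  have e : L.deltaI u I = fun x => (∑ J ∈ ch, avgInd u J x) - avgInd u I x := by
    funext x; exact h.delta u x
  have i1 : ∀ J ∈ ch, Integrable (fun x => avgInd u J x) := fun J hJ =>
    avgInd_integrable (gen_meas (h.sub J hJ).1) (gen_fin (h.sub J hJ).1) u
  have key : ∀ {m : ℤ} {A : Set ℝ}, A ∈ L.gen m → ∫ x, avgInd u A x = ∫ x in A, u x := by
    intro m A hA
    rw [avgInd, integral_indicator_const _ (gen_meas hA), measureReal_def, smul_eq_mul,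
      avg_mul_vol hA]
  rw [e, integral_sub (integrable_finsetSum _ i1)
    (avgInd_integrable (gen_meas h.mem) (gen_fin h.mem) u), integral_finsetSum _ i1, key h.mem,
    ← h.split hu, sub_eq_zero]
  apply Finset.sum_congr rfl
  intro J hJ
  exact key (h.sub J hJ).1

lemma delta_setIntegral {I A : Set ℝ} {u : ℝ → ℝ}
    (hu : Integrable (L.deltaI u I)) (hu' : IntegrableOn u I) (hA : MeasurableSet A)
    (h : I ⊆ A ∨ Disjoint I A) :
    ∫ x in A, L.deltaI u I x = 0 := by
  by_cases hI : (L.children I).Nonempty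
  · obtain ⟨k, ch, hc⟩ := exists_ch I hI
    rcases h with h | h
    · rw [setIntegral_eq_integral_of_forall_compl_eq_zero, hc.integral_delta hu']
      intro x hx
      exact hc.delta_out (fun hxI => hx (h hxI)) u
    · rw [setIntegral_congr_fun hA (g := fun _ => 0)]
      · simp
      · intro x hx
        exact hc.delta_out (fun hxI => Set.disjoint_left.1 h hxI hx) u
  · simp [delta_zero hI]

/-- orthogonality of different martingale differences -/
lemma delta_delta_ne {I J : Set ℝ} (hne : I ≠ J) {u : ℝ → ℝ}
    (hu : IntegrableOn u I) (x : ℝ) : L.deltaI (L.deltaI u I) J x = 0 := by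
  by_cases hJ : (L.children J).Nonempty
  swap
  · rw [delta_zero hJ]
  by_cases hI : (L.children I).Nonempty
  swap
  · exact delta_of_const 0 (fun y _ => delta_zero hI u y) x
  obtain ⟨k, ch, hc⟩ := exists_ch I hI
  obtain ⟨m, dh, hd⟩ := exists_ch J hJ
  have hdint := delta_integrable (L := L) I u
  rcases lt_trichotomy k m with hkm | hkm | hkm
  · -- `J` is finer than the children of `I`
    have h1 : ∀ A ∈ ch, ∃ c, ∀ y ∈ J, avgInd u A y = c := fun A hA =>
      avgInd_const_on (nested (by omega) (hc.sub A hA).1 hd.mem) u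
    obtain ⟨c, h2⟩ := avgInd_const_on (nested hkm.le hc.mem hd.mem) u
    choose! φ hφ using h1
    refine delta_of_const ((∑ A ∈ ch, φ A) - c) (fun y hy => ?_) x
    rw [hc.delta, h2 y hy]
    congr 1
    exact Finset.sum_congr rfl fun A hA => hφ A hA y hy
  · subst hkm
    have hdis := L.pairwise_disjoint k hc.mem hd.mem hne
    exact delta_of_const 0
      (fun y hy => hc.delta_out (fun hyI => Set.disjoint_left.1 hdis hyI hy) u) x
  · by_cases hx : x ∈ J
    · obtain ⟨B, hB, hxB⟩ := hd.cov x hx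
      rw [hd.delta_in hB hxB]
      have hBg := (hd.sub B hB).1
      rw [avgOn, avgOn,
        delta_setIntegral hdint hu (gen_meas hBg) (nested (by omega) hBg hc.mem),
        delta_setIntegral hdint hu (gen_meas hd.mem) (nested hkm.le hd.mem hc.mem)]
      simp
    · rw [hd.delta_out hx]

lemma delta_delta_self {I : Set ℝ} {u : ℝ → ℝ}
    (hu : IntegrableOn u I) (x : ℝ) : L.deltaI (L.deltaI u I) I x = L.deltaI u I x := by
  by_cases hI : (L.children I).Nonempty
  swap
  · rw [delta_zero hI, delta_zero hI]
  obtain ⟨k, ch, hc⟩ := exists_ch I hI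
  by_cases hx : x ∈ I
  · obtain ⟨B, hB, hxB⟩ := hc.cov x hx
    have hBg := (hc.sub B hB).1
    rw [hc.delta_in hB hxB,
      avgOn_congr_const (gen_meas hBg) (gen_pos hBg) (fun y hy => hc.delta_in hB hy u),
      hc.delta_in hB hxB]
    have : avgOn (L.deltaI u I) I = 0 := by
      rw [avgOn, delta_setIntegral (delta_integrable I u) hu (gen_meas hc.mem)
        (Or.inl subset_rfl), mul_zero]
    rw [this, sub_zero]
  · rw [hc.delta_out hx, hc.delta_out hx]

lemma avgOn_add {u v : ℝ → ℝ} (hu : Integrable u) (hv : Integrable v) (A : Set ℝ) :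
    avgOn (fun x => u x + v x) A = avgOn u A + avgOn v A := by
  simp only [avgOn]
  rw [integral_add hu.integrableOn hv.integrableOn, mul_add]

lemma delta_add {u v : ℝ → ℝ} (hu : Integrable u) (hv : Integrable v) (I : Set ℝ) (x : ℝ) :
    L.deltaI (fun x => u x + v x) I x = L.deltaI u I x + L.deltaI v I x := by
  by_cases hI : (L.children I).Nonempty
  swap
  · simp [delta_zero hI]
  obtain ⟨k, ch, hc⟩ := exists_ch I hI
  by_cases hx : x ∈ I
  · obtain ⟨B, hB, hxB⟩ := hc.cov x hx
    rw [hc.delta_in hB hxB, hc.delta_in hB hxB, hc.delta_in hB hxB, avgOn_add hu hv,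
      avgOn_add hu hv]
    ring
  · simp [hc.delta_out hx]

lemma delta_sum (T : Finset (Set ℝ)) {u : Set ℝ → ℝ → ℝ} (hu : ∀ A ∈ T, Integrable (u A))
    (I : Set ℝ) (x : ℝ) :
    L.deltaI (fun x => ∑ A ∈ T, u A x) I x = ∑ A ∈ T, L.deltaI (u A) I x := by
  induction T using Finset.induction_on with
  | empty =>
    simp only [Finset.sum_empty]
    exact delta_of_const 0 (fun _ _ => rfl) x
  | insert a T ha ih =>
    simp only [Finset.sum_insert ha]
    rw [delta_add (hu a (Finset.mem_insert_self _ _)), ih]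
    · intro A hA; exact hu A (Finset.mem_insert_of_mem hA)
    · exact integrable_finsetSum _ fun A hA => hu A (Finset.mem_insert_of_mem hA)

lemma afin_meas {K : Set ℝ} (hK : K ∈ L.AFin) : MeasurableSet K := by
  obtain ⟨_, c, hc, _, rfl⟩ := hK
  exact MeasurableSet.iUnion fun k => gen_meas (hc k)

lemma afin_nested {K J : Set ℝ} (hK : K ∈ L.AFin) (hJ : J ∈ L.lat) : J ⊆ K ∨ Disjoint J K := by
  obtain ⟨_, c, hc, hs, rfl⟩ := hK
  obtain ⟨m, hJ⟩ := hJ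
  have hanti : Antitone c := by
    apply antitone_int_of_succ_le
    intro n
    have := hs (n + 1)
    simpa using this
  by_cases h : Disjoint J (⋃ k, c k)
  · right; exact h
  · left
    obtain ⟨x, hx, hx'⟩ := Set.not_disjoint_iff.1 h
    obtain ⟨k, hk⟩ := Set.mem_iUnion.1 hx'
    have hxm : x ∈ c (min k m) := hanti (min_le_left _ _) hk
    have := (nested (min_le_right k m) (hc _) hJ).resolve_right
      fun hd => Set.disjoint_left.1 hd hx hxm
    exact this.trans (Set.subset_iUnion c _)

lemma delta_avg {K J : Set ℝ} (hK : K ∈ L.AFin) (hJ : J ∈ L.lat) (u : ℝ → ℝ) (x : ℝ) :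
    L.deltaI (avgInd u K) J x = 0 := by
  obtain ⟨c, hc⟩ := avgInd_const_on (afin_nested hK hJ) u
  exact delta_of_const c hc x

/-- Jensen -/
lemma avg_sq {k : ℤ} {A : Set ℝ} (hA : A ∈ L.gen k) {h : ℝ → ℝ} (hm : Measurable h)
    (hb : ∀ x, |h x| ≤ 1) :
    (volume A).toReal * avgOn h A ^ 2 ≤ ∫ x in A, h x ^ 2 := by
  have i0 : IntegrableOn (fun _ : ℝ => (1 : ℝ)) A := integrableOn_const (gen_fin hA).ne
  have i1 : IntegrableOn h A := Integrable.mono' i0 hm.aestronglyMeasurable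
    (Eventually.of_forall hb)
  have i2 : IntegrableOn (fun x => h x ^ 2) A := by
    refine Integrable.mono' i0 (hm.pow_const 2).aestronglyMeasurable
      (Eventually.of_forall fun x => ?_)
    rw [Real.norm_eq_abs, abs_pow]
    exact pow_le_one₀ (abs_nonneg _) (hb x)
  set c := avgOn h A with hc
  have h0 : 0 ≤ ∫ x in A, (h x - c) ^ 2 := integral_nonneg fun x => sq_nonneg _
  have e : ∫ x in A, (h x - c) ^ 2 = (∫ x in A, h x ^ 2) - 2 * c * (∫ x in A, h x)
      + (volume A).toReal * c ^ 2 := by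
    have : (fun x => (h x - c) ^ 2) = fun x => (h x ^ 2 - 2 * c * h x) + c ^ 2 := by
      funext x; ring
    have i3 : IntegrableOn (fun x => h x ^ 2 - 2 * c * h x) A := i2.sub (i1.const_mul _)
    rw [this, integral_add i3 (integrableOn_const (gen_fin hA).ne),
      integral_sub i2 (i1.const_mul _), integral_const_mul, setIntegral_const, measureReal_def,
      smul_eq_mul]
  rw [e, ← avg_mul_vol hA h, ← hc] at h0
  nlinarith

lemma delta_L2 {I : Set ℝ} {h : ℝ → ℝ} (hm : Measurable h) (hb : ∀ x, |h x| ≤ 1) :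
    ∫⁻ x, ENNReal.ofReal (L.deltaI h I x ^ 2) ≤ 4 * ∫⁻ x in I, ENNReal.ofReal (h x ^ 2) := by
  by_cases hI : (L.children I).Nonempty
  swap
  · simp [delta_zero hI]
  obtain ⟨k, ch, hc⟩ := exists_ch I hI
  have key : ∀ {m : ℤ} {A : Set ℝ}, A ∈ L.gen m →
      Integrable (A.indicator fun _ => avgOn h A ^ 2) ∧
      ∫ x, A.indicator (fun _ => avgOn h A ^ 2) x ≤ ∫ x in A, h x ^ 2 := by
    intro m A hA
    refine ⟨(integrable_indicator_iff (gen_meas hA)).2 (integrableOn_const (gen_fin hA).ne), ?_⟩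
    rw [integral_indicator_const _ (gen_meas hA), measureReal_def, smul_eq_mul]
    exact avg_sq hA hm hb
  have i0 : IntegrableOn (fun _ : ℝ => (1 : ℝ)) I := integrableOn_const (gen_fin hc.mem).ne
  have i2 : IntegrableOn (fun x => h x ^ 2) I := by
    refine Integrable.mono' i0 (hm.pow_const 2).aestronglyMeasurable
      (Eventually.of_forall fun x => ?_)
    rw [Real.norm_eq_abs, abs_pow]
    exact pow_le_one₀ (abs_nonneg _) (hb x)
  set P : ℝ → ℝ := fun x => 2 * (∑ J ∈ ch, J.indicator (fun _ => avgOn h J ^ 2) x)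
    + 2 * I.indicator (fun _ => avgOn h I ^ 2) x with hP
  have hPi1 : ∀ J ∈ ch, Integrable (fun x => J.indicator (fun _ => avgOn h J ^ 2) x) :=
    fun J hJ => (key (hc.sub J hJ).1).1
  have hPi : Integrable P :=
    ((integrable_finsetSum _ hPi1).const_mul 2).add ((key hc.mem).1.const_mul 2)
  have hle : ∀ x, L.deltaI h I x ^ 2 ≤ P x := by
    intro x
    by_cases hx : x ∈ I
    · obtain ⟨B, hB, hxB⟩ := hc.cov x hx
      rw [hc.delta_in hB hxB, hP]
      simp only
      rw [hc.sum hB hxB (fun A => avgOn h A ^ 2), Set.indicator_of_mem hx]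
      nlinarith [sq_nonneg (avgOn h B + avgOn h I)]
    · rw [hc.delta_out hx, hP]
      simp only
      rw [hc.sum_out hx (fun A => avgOn h A ^ 2), Set.indicator_of_notMem hx]
      simp
  have hPint : ∫ x, P x ≤ 4 * ∫ x in I, h x ^ 2 := by
    rw [hP, integral_add ((integrable_finsetSum _ hPi1).const_mul 2)
      ((key hc.mem).1.const_mul 2), integral_const_mul, integral_const_mul,
      integral_finsetSum _ hPi1]
    have a1 := (key hc.mem).2
    have a2 : ∑ J ∈ ch, ∫ x, J.indicator (fun _ => avgOn h J ^ 2) x ≤ ∫ x in I, h x ^ 2 := by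
      rw [← hc.split i2]
      exact Finset.sum_le_sum fun J hJ => (key (hc.sub J hJ).1).2
    linarith
  calc ∫⁻ x, ENNReal.ofReal (L.deltaI h I x ^ 2) ≤ ∫⁻ x, ENNReal.ofReal (P x) :=
        lintegral_mono fun x => ENNReal.ofReal_le_ofReal (hle x)
    _ = ENNReal.ofReal (∫ x, P x) := by
        rw [ofReal_integral_eq_lintegral_ofReal hPi]
        exact Eventually.of_forall fun x => (sq_nonneg _).trans (hle x)
    _ ≤ ENNReal.ofReal (4 * ∫ x in I, h x ^ 2) := ENNReal.ofReal_le_ofReal hPint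
    _ = 4 * ∫⁻ x in I, ENNReal.ofReal (h x ^ 2) := by
        rw [ENNReal.ofReal_mul (by norm_num), ofReal_integral_eq_lintegral_ofReal i2]
        · norm_num
        · exact Eventually.of_forall fun x => sq_nonneg _

lemma tsum_fin {M : Type*} [AddCommMonoid M] [TopologicalSpace M] [T2Space M] {s : Set (Set ℝ)}
    {T : Finset (Set ℝ)} (hT : ∀ A ∈ T, A ∈ s) {φ : Set ℝ → M}
    (h : ∀ A ∈ s, A ∉ T → φ A = 0) : ∑' A : s, φ A.1 = ∑ A ∈ T, φ A := by
  rw [tsum_subtype s φ, tsum_eq_sum (s := T)]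
  · exact Finset.sum_congr rfl fun A hA => Set.indicator_of_mem (hT A hA) _
  · intro A hA
    by_cases hs : A ∈ s
    · rw [Set.indicator_of_mem hs]; exact h A hs hA
    · exact Set.indicator_of_notMem hs _

end RLattice

/-- there is an absolute constant `C > 0` such that for every lattice `ℒ` and
every `𝔄_∞`-measurable `f` with only finitely many nonzero `Δ_I f`, `I ∈ ℒ`, and `E_I f`,
`I ∈ 𝔄⁰_{-∞,fin}`, and `f = Σ_{I ∈ ℒ} Δ_I f + Σ_{I ∈ 𝔄⁰_{-∞,fin}} E_I f`, there is a
martingale BMO function `g` with `‖g‖_BMO ≤ C` and `∫ Sf = ∫ fg`. -/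
theorem stmt17 :
    ∃ C : ℝ, 0 < C ∧
      ∀ (L : RLattice) (f : ℝ → ℝ), L.AInfMeasurable f →
        {I | I ∈ L.lat ∧ ∃ x, L.deltaI f I x ≠ 0}.Finite →
        {I | I ∈ L.AFin ∧ ∃ x, avgInd f I x ≠ 0}.Finite →
        (∀ x, f x = (∑' I : L.lat, L.deltaI f I.1 x) + ∑' I : L.AFin, avgInd f I.1 x) →
        ∃ g : ℝ → ℝ,
          MeasureTheory.LocallyIntegrable g MeasureTheory.volume ∧
          L.IsBMOWith g C ∧
          MeasureTheory.Integrable (fun x => f x * g x) MeasureTheory.volume ∧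
          (∫⁻ x, L.sqFn f x) = ENNReal.ofReal (∫ x, f x * g x) := by
  refine ⟨2, by norm_num, ?_⟩
  intro L f _ hF hG hf
  set F := hF.toFinset with hFdef
  set G := hG.toFinset with hGdef
  have F1 : ∀ A ∈ F, A ∈ L.lat := by
    intro A hA
    exact ((Set.Finite.mem_toFinset hF).1 hA).1
  have F2 : ∀ A ∈ L.lat, A ∉ F → ∀ x, L.deltaI f A x = 0 := by
    intro A hA hn x
    by_contra h
    exact hn ((Set.Finite.mem_toFinset hF).2 ⟨hA, x, h⟩)
  have G1 : ∀ A ∈ G, A ∈ L.AFin := by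
    intro A hA
    exact ((Set.Finite.mem_toFinset hG).1 hA).1
  have G2 : ∀ A ∈ L.AFin, A ∉ G → ∀ x, avgInd f A x = 0 := by
    intro A hA hn x
    by_contra h
    exact hn ((Set.Finite.mem_toFinset hG).2 ⟨hA, x, h⟩)
  clear_value F G
  -- integrability of `f`
  have hfi : Integrable f := by
    have : f = fun x => (∑ I ∈ F, L.deltaI f I x) + ∑ K ∈ G, avgInd f K x := by
      funext x
      refine (hf x).trans ?_
      rw [RLattice.tsum_fin F1 (φ := fun A => L.deltaI f A x) (fun A hA hn => F2 A hA hn x),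
        RLattice.tsum_fin G1 (φ := fun A => avgInd f A x) (fun A hA hn => G2 A hA hn x)]
    rw [this]
    exact (integrable_finsetSum _ fun I _ => RLattice.delta_integrable I _).add
      (integrable_finsetSum _ fun K hK =>
        RLattice.avgInd_integrable (RLattice.afin_meas (G1 K hK)) (G1 K hK).1 _)
  set Q : ℝ → ℝ := fun x => (∑ I ∈ F, L.deltaI f I x ^ 2) + ∑ K ∈ G, avgInd f K x ^ 2 with hQ
  have Q0 : ∀ x, 0 ≤ Q x := fun x => add_nonneg (Finset.sum_nonneg fun _ _ => sq_nonneg _)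
    (Finset.sum_nonneg fun _ _ => sq_nonneg _)
  set S : ℝ → ℝ := fun x => Real.sqrt (Q x) with hS
  have S0 : ∀ x, 0 ≤ S x := fun x => Real.sqrt_nonneg _
  have SS : ∀ x, S x ^ 2 = Q x := fun x => Real.sq_sqrt (Q0 x)
  have Qm : Measurable Q := by
    refine (Finset.measurable_sum _ fun I _ => (RLattice.delta_measurable I f).pow_const 2).add
      (Finset.measurable_sum _ fun K hK =>
        (RLattice.avgInd_measurable (RLattice.afin_meas (G1 K hK)) f).pow_const 2)
  have Sm : Measurable S := Qm.sqrt
  have hSq : ∀ x, L.sqFn f x = ENNReal.ofReal (S x) := by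
    intro x
    rw [RLattice.sqFn,
      RLattice.tsum_fin F1 (φ := fun A => ENNReal.ofReal (L.deltaI f A x ^ 2))
        (fun A hA hn => by simp [F2 A hA hn x]),
      RLattice.tsum_fin G1 (φ := fun A => ENNReal.ofReal (avgInd f A x ^ 2))
        (fun A hA hn => by simp [G2 A hA hn x]),
      ← ENNReal.ofReal_sum_of_nonneg (fun _ _ => sq_nonneg _),
      ← ENNReal.ofReal_sum_of_nonneg (fun _ _ => sq_nonneg _),
      ← ENNReal.ofReal_add (Finset.sum_nonneg fun _ _ => sq_nonneg _)
        (Finset.sum_nonneg fun _ _ => sq_nonneg _),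
      ENNReal.ofReal_rpow_of_nonneg (Q0 x) (by norm_num), ← Real.sqrt_eq_rpow]
  -- the test functions
  set h : Set ℝ → ℝ → ℝ := fun I x => L.deltaI f I x / S x with hh
  set e : Set ℝ → ℝ → ℝ := fun K x => avgInd f K x / S x with he
  have hm : ∀ I, Measurable (h I) := fun I => (RLattice.delta_measurable I f).div Sm
  have em : ∀ K ∈ G, Measurable (e K) := fun K hK =>
    (RLattice.avgInd_measurable (RLattice.afin_meas (G1 K hK)) f).div Sm
  have bd : ∀ (a : ℝ) (x : ℝ), a ^ 2 ≤ Q x → |a / S x| ≤ 1 := by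
    intro a x ha
    rw [abs_div, abs_of_nonneg (S0 x)]
    refine div_le_one_of_le₀ ?_ (S0 x)
    exact Real.abs_le_sqrt ha
  have hb : ∀ I ∈ F, ∀ x, |h I x| ≤ 1 := by
    intro I hI x
    apply bd
    have h1 : L.deltaI f I x ^ 2 ≤ ∑ I ∈ F, L.deltaI f I x ^ 2 :=
      Finset.single_le_sum (f := fun I => L.deltaI f I x ^ 2) (fun _ _ => sq_nonneg _) hI
    have h2 : 0 ≤ ∑ K ∈ G, avgInd f K x ^ 2 := Finset.sum_nonneg fun _ _ => sq_nonneg _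
    simp only [hQ]; linarith
  have eb : ∀ K ∈ G, ∀ x, |e K x| ≤ 1 := by
    intro K hK x
    apply bd
    have h1 : avgInd f K x ^ 2 ≤ ∑ K ∈ G, avgInd f K x ^ 2 :=
      Finset.single_le_sum (f := fun K => avgInd f K x ^ 2) (fun _ _ => sq_nonneg _) hK
    have h2 : 0 ≤ ∑ I ∈ F, L.deltaI f I x ^ 2 := Finset.sum_nonneg fun _ _ => sq_nonneg _
    simp only [hQ]; linarith
  have hsum : ∀ x, ∑ I ∈ F, h I x ^ 2 ≤ 1 := by
    intro x
    have h2 : 0 ≤ ∑ K ∈ G, avgInd f K x ^ 2 := Finset.sum_nonneg fun _ _ => sq_nonneg _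
    simp only [hh, div_pow]
    rw [← Finset.sum_div, SS]
    refine div_le_one_of_le₀ ?_ (Q0 x)
    simp only [hQ]; linarith
  have hSsum : ∀ x, S x = (∑ I ∈ F, L.deltaI f I x * h I x) + ∑ K ∈ G, avgInd f K x * e K x := by
    intro x
    have : (∑ I ∈ F, L.deltaI f I x * h I x) + ∑ K ∈ G, avgInd f K x * e K x = Q x / S x := by
      simp only [hh, he, hQ, add_div, Finset.sum_div]
      congr 1 <;> exact Finset.sum_congr rfl fun _ _ => by ring
    rw [this, ← SS, sq, mul_self_div_self]
  have hloc : ∀ I ∈ F, IntegrableOn (h I) I := by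
    intro I hI
    obtain ⟨k, hk⟩ := F1 I hI
    have i0 : IntegrableOn (fun _ : ℝ => (1 : ℝ)) I :=
      integrableOn_const (RLattice.gen_fin hk).ne
    exact Integrable.mono' i0 (hm I).aestronglyMeasurable (Eventually.of_forall (hb I hI))
  have gi1 : ∀ I ∈ F, Integrable (L.deltaI (h I) I) := fun I _ => RLattice.delta_integrable I _
  have gi2 : ∀ K ∈ G, Integrable (avgInd (e K) K) := fun K hK =>
    RLattice.avgInd_integrable (RLattice.afin_meas (G1 K hK)) (G1 K hK).1 _
  set g : ℝ → ℝ := fun x => (∑ I ∈ F, L.deltaI (h I) I x) + ∑ K ∈ G, avgInd (e K) K x with hg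
  have gi : Integrable g := (integrable_finsetSum _ gi1).add (integrable_finsetSum _ gi2)
  have gdelta : ∀ J ∈ L.lat, ∀ x, L.deltaI g J x = if J ∈ F then L.deltaI (h J) J x else 0 := by
    intro J hJ x
    rw [hg, RLattice.delta_add (integrable_finsetSum _ gi1) (integrable_finsetSum _ gi2),
      RLattice.delta_sum F gi1, RLattice.delta_sum G gi2,
      Finset.sum_eq_zero (s := G) (fun K hK => RLattice.delta_avg (G1 K hK) hJ _ x), add_zero]
    split_ifs with hJF
    · rw [Finset.sum_eq_single J]
      · exact RLattice.delta_delta_self (hloc J hJF) x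
      · intro I hI hne
        exact RLattice.delta_delta_ne hne (hloc I hI) x
      · intro h'; exact absurd hJF h'
    · apply Finset.sum_eq_zero
      intro I hI
      exact RLattice.delta_delta_ne (fun h' : I = J => hJF (by rwa [← h'])) (hloc I hI) x
  have fe : (fun x => f x * g x) = fun x => (∑ I ∈ F, f x * L.deltaI (h I) I x)
      + ∑ K ∈ G, f x * avgInd (e K) K x := by
    funext x
    simp only [hg, mul_add, Finset.mul_sum]
  have fi1 : ∀ I ∈ F, Integrable (fun x => f x * L.deltaI (h I) I x) := fun I _ =>
    RLattice.mul_delta_integrable hfi _ I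
  have fi2 : ∀ K ∈ G, Integrable (fun x => f x * avgInd (e K) K x) := fun K hK =>
    RLattice.mul_avgInd_integrable hfi _ (RLattice.afin_meas (G1 K hK))
  have si1 : ∀ I ∈ F, Integrable (fun x => L.deltaI f I x * h I x) := by
    intro I hI
    refine Integrable.mono' (RLattice.delta_integrable (L := L) I f).abs
      ((RLattice.delta_measurable I f).mul (hm I)).aestronglyMeasurable ?_
    refine Eventually.of_forall fun x => ?_
    rw [Real.norm_eq_abs, abs_mul]
    exact mul_le_of_le_one_right (abs_nonneg _) (hb I hI x)
  have si2 : ∀ K ∈ G, Integrable (fun x => avgInd f K x * e K x) := fun K hK =>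
    RLattice.bdd_integrable (RLattice.afin_meas (G1 K hK)) (G1 K hK).1 (em K hK) (eb K hK) f
  refine ⟨g, gi.locallyIntegrable, ⟨?_, ?_⟩, ?_, ?_⟩
  · intro I hI
    set T := F.filter (fun J => J ⊆ I) with hT
    have T1 : ∀ A ∈ T, A ∈ {J : Set ℝ | J ∈ L.lat ∧ J ⊆ I} := fun A hA =>
      ⟨F1 A (Finset.mem_filter.1 hA).1, (Finset.mem_filter.1 hA).2⟩
    have conv : ∀ x, ∑' J : {J : Set ℝ // J ∈ L.lat ∧ J ⊆ I},
        ENNReal.ofReal ((L.deltaI g J.1 x) ^ 2) =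
        ∑ J ∈ T, ENNReal.ofReal ((L.deltaI (h J) J x) ^ 2) := by
      intro x
      have := RLattice.tsum_fin T1 (φ := fun A => ENNReal.ofReal (L.deltaI g A x ^ 2))
        (fun A hA hn => by
          have : A ∉ F := fun hAF => hn (Finset.mem_filter.2 ⟨hAF, hA.2⟩)
          simp [gdelta A hA.1, this])
      refine Eq.trans this ?_
      apply Finset.sum_congr rfl
      intro J hJ
      rw [gdelta J (T1 J hJ).1, if_pos (Finset.mem_filter.1 hJ).1]
    simp only [conv]
    rw [lintegral_finsetSum _ fun J _ =>
      ((RLattice.delta_measurable J (h J)).pow_const 2).ennreal_ofReal]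
    calc ∑ J ∈ T, ∫⁻ x in I, ENNReal.ofReal ((L.deltaI (h J) J x) ^ 2)
        ≤ ∑ J ∈ T, 4 * ∫⁻ x in I, ENNReal.ofReal (h J x ^ 2) := by
          apply Finset.sum_le_sum
          intro J hJ
          have hJF := (Finset.mem_filter.1 hJ).1
          refine (setLIntegral_le_lintegral _ _).trans
            ((RLattice.delta_L2 (hm J) (hb J hJF)).trans ?_)
          gcongr
          exact (T1 J hJ).2
      _ = 4 * ∫⁻ x in I, ∑ J ∈ T, ENNReal.ofReal (h J x ^ 2) := by
          rw [lintegral_finsetSum _ fun J _ => ((hm J).pow_const 2).ennreal_ofReal,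
            Finset.mul_sum]
      _ ≤ 4 * ∫⁻ _ in I, 1 := by
          gcongr with x
          rw [← ENNReal.ofReal_sum_of_nonneg (fun _ _ => sq_nonneg _)]
          refine ENNReal.ofReal_le_one.2 (le_trans ?_ (hsum x))
          exact Finset.sum_le_sum_of_subset_of_nonneg (Finset.filter_subset _ _)
            fun _ _ _ => sq_nonneg _
      _ = ENNReal.ofReal (2 ^ 2) * volume I := by
          rw [setLIntegral_one]
          norm_num
  · intro I hI
    refine Eventually.of_forall fun x => ?_
    rw [gdelta I hI]
    split_ifs with hIF
    · exact RLattice.delta_bdd (hb I hIF) I x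
    · simp
  · rw [fe]
    exact (integrable_finsetSum _ fi1).add (integrable_finsetSum _ fi2)
  · have hSe : S = fun x => (∑ I ∈ F, L.deltaI f I x * h I x) + ∑ K ∈ G, avgInd f K x * e K x :=
      funext hSsum
    have Si : Integrable S := by
      rw [hSe]
      exact (integrable_finsetSum _ si1).add (integrable_finsetSum _ si2)
    simp only [hSq]
    rw [← ofReal_integral_eq_lintegral_ofReal Si (Eventually.of_forall S0)]
    congr 1
    have eS : ∫ x, S x = (∑ I ∈ F, ∫ x, L.deltaI f I x * h I x)
        + ∑ K ∈ G, ∫ x, avgInd f K x * e K x := by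
      rw [integral_congr_ae (Eventually.of_forall hSsum),
        integral_add (integrable_finsetSum _ si1) (integrable_finsetSum _ si2),
        integral_finsetSum _ si1, integral_finsetSum _ si2]
    rw [eS, fe, integral_add (integrable_finsetSum _ fi1) (integrable_finsetSum _ fi2),
      integral_finsetSum _ fi1, integral_finsetSum _ fi2]
    congr 1
    · exact Finset.sum_congr rfl fun I hI =>
        (RLattice.delta_selfadj hfi (hm I) (hb I hI) I).symm
    · exact Finset.sum_congr rfl fun K hK =>
        (RLattice.avg_selfadj f (e K) (RLattice.afin_meas (G1 K hK))).symm

end
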